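/- arXiv:1408.1491 — 3 statements merged into one kernel-verified Lean document; each statement's English description precedes it below -/
import Mathlib

section
/- Let K be an algebraically closed field and let A be a finite-dimensional associative (possibly non-unital) algebra over K. If every commutative (non-unital) subalgebra of A has dimension at most n, then 2 · dim A ≤ n² + 10n. -/
/-- Lie's theorem in arbitrary characteristic, for a Lie algebra whose commutators lie in an ideal
acting nilpotently. -/
theorem exists_common_lie_eigenvector {K L V : Type*} [Field K] [IsAlgClosed K]
    [LieRing L] [LieAlgebra K L] [FiniteDimensional K L] [AddCommGroup V] [Module K V]
    [LieRingModule L V] [LieModule K L V] [FiniteDimensional K V] [Nontrivial V]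
    (N : LieIdeal K L) (hN : ∀ x y : L, ⁅x, y⁆ ∈ N)
    (hnil : ∀ x ∈ N, IsNilpotent (LieModule.toEnd K L V x)) :
    ∃ v : V, v ≠ 0 ∧ ∀ x : L, ∃ c : K, ⁅x, v⁆ = c • v := by
  obtain ⟨W, hW⟩ := IsAtomic.exists_atom (LieSubmodule K L V)
  have hle : ∀ E : LieSubmodule K L V, (∃ w ∈ W, w ∈ E ∧ w ≠ 0) → W ≤ E := by
    rintro E ⟨w, hwW, hwE, hw0⟩
    rcases hW.le_iff.1 (inf_le_left : W ⊓ E ≤ W) with h | h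
    · exact absurd ((LieSubmodule.mem_bot w).1 (h.le ⟨hwW, hwE⟩)) hw0
    · exact h ▸ inf_le_right
  have : Nontrivial W := (LieSubmodule.nontrivial_iff_ne_bot K L V).2 hW.1
  let D : LieSubmodule K L V :=
    { carrier := {v | ∀ n ∈ N, ⁅n, v⁆ = 0}
      zero_mem' := by simp
      add_mem' := fun ha hb n hn => by rw [lie_add, ha n hn, hb n hn, add_zero]
      smul_mem' := fun c v hv n hn => by rw [lie_smul, hv n hn, smul_zero]
      lie_mem := fun {x v} hv n hn => by
        rw [leibniz_lie, hv n hn, lie_zero, add_zero, hv _ (hN n x)] }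
  have hWD : W ≤ D := by
    have hW' : LieModule.IsNilpotent N W := by
      rw [LieModule.isNilpotent_iff_forall (R := K)]
      intro x
      obtain ⟨k, hk⟩ := hnil x x.2
      refine ⟨k, LinearMap.ext fun w => Subtype.ext ?_⟩
      have h : ∀ j : ℕ, (((LieModule.toEnd K N W x ^ j) w : W) : V) =
          (LieModule.toEnd K L V x ^ j) w := by
        intro j
        induction j with
        | zero => simp
        | succ j ih =>
          rw [pow_succ', pow_succ', Module.End.mul_apply, Module.End.mul_apply, ← ih]
          rfl
      rw [h, hk]; rfl
    obtain ⟨w, hw⟩ := @exists_ne _ (LieModule.nontrivial_max_triv_of_isNilpotent K N W) 0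
    refine hle D ⟨w.1.1, w.1.2, fun n hn => ?_, fun h => hw (Subtype.ext (Subtype.ext h))⟩
    exact congrArg Subtype.val ((LieModule.mem_maxTrivSubmodule K N W w.1).1 w.2 ⟨n, hn⟩)
  obtain ⟨v, hv⟩ := exists_ne (0 : W)
  refine ⟨v, fun h => hv (Subtype.ext h), fun x => ?_⟩
  obtain ⟨c, hc⟩ := Module.End.exists_eigenvalue (LieModule.toEnd K L W x)
  obtain ⟨w, hw⟩ := hc.exists_hasEigenvector
  let E : LieSubmodule K L V :=
    { carrier := {v | v ∈ D ∧ ⁅x, v⁆ = c • v}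
      zero_mem' := by simp
      add_mem' := fun ha hb => ⟨D.add_mem ha.1 hb.1, by rw [lie_add, ha.2, hb.2, smul_add]⟩
      smul_mem' := fun d v hv => ⟨D.smul_mem d hv.1, by rw [lie_smul, hv.2, smul_comm]⟩
      lie_mem := fun {y v} hv => ⟨D.lie_mem hv.1, by
        rw [leibniz_lie, hv.1 _ (hN x y), zero_add, hv.2, lie_smul]⟩ }
  refine ⟨c, (hle E ⟨w, w.2, ⟨hWD w.2, ?_⟩, fun h => hw.2 (Subtype.ext h)⟩ v.2).2⟩
  exact congrArg Subtype.val hw.apply_eq_smul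

/-- If `C` is an ideal not contained in the ideal `I`, then `C` contains an eigenvector of the
adjoint action modulo `I`. -/
theorem exists_lie_eigenvector_mod_ideal {K L : Type*} [Field K] [IsAlgClosed K]
    [LieRing L] [LieAlgebra K L] [FiniteDimensional K L]
    (N : LieIdeal K L) (hN : ∀ x y : L, ⁅x, y⁆ ∈ N)
    (hnil : ∀ x ∈ N, IsNilpotent (LieAlgebra.ad K L x)) (I C : LieIdeal K L) (h : ¬ C ≤ I) :
    ∃ x ∈ C, x ∉ I ∧ ∀ y : L, ∃ c : K, ⁅y, x⁆ - c • x ∈ I := by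
  let V : LieSubmodule K L (L ⧸ I) := LieSubmodule.map (LieSubmodule.Quotient.mk' I) C
  have hV : V ≠ ⊥ := fun hV => h ((LieSubmodule.Quotient.map_mk'_eq_bot_le _ _).1 hV)
  have : Nontrivial V := (LieSubmodule.nontrivial_iff_ne_bot K L _).2 hV
  obtain ⟨⟨v, hvV⟩, hv0, hv⟩ := exists_common_lie_eigenvector (V := V) N hN (by
    intro n hn
    obtain ⟨k, hk⟩ := hnil n hn
    refine ⟨k, LinearMap.ext fun w => Subtype.ext ?_⟩
    obtain ⟨w, hw⟩ := w
    obtain ⟨u, hu, rfl⟩ := (LieSubmodule.mem_map _).1 hw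
    have key : ∀ j : ℕ, (((LieModule.toEnd K L V n ^ j) ⟨_, hw⟩ : V) : L ⧸ I) =
        LieSubmodule.Quotient.mk' I ((LieAlgebra.ad K L n ^ j) u) := by
      intro j
      induction j with
      | zero => simp
      | succ j ih =>
        rw [pow_succ', pow_succ', Module.End.mul_apply, Module.End.mul_apply,
          LieAlgebra.ad_apply, LieModuleHom.map_lie, ← ih]
        rfl
    rw [key, hk]; simp)
  obtain ⟨x, hx, rfl⟩ := (LieSubmodule.mem_map _).1 hvV
  refine ⟨x, hx, fun hxI => hv0 (Subtype.ext ((LieSubmodule.Quotient.mk_eq_zero I).2 hxI)),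
    fun y => ?_⟩
  obtain ⟨c, hc⟩ := hv y
  refine ⟨c, (LieSubmodule.Quotient.mk_eq_zero I).1 ?_⟩
  have := congrArg Subtype.val hc
  rw [map_sub, LieModuleHom.map_lie, map_smul]
  exact sub_eq_zero.2 this

/-- The elements of the ideal `P` centralizing the ideal `I`, as an ideal. -/
def LieIdeal.centralizerIn {K L : Type*} [CommRing K] [LieRing L] [LieAlgebra K L]
    (P I : LieIdeal K L) : LieIdeal K L where
  carrier := {x | x ∈ P ∧ ∀ y ∈ I, ⁅x, y⁆ = 0}
  zero_mem' := by simp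
  add_mem' := fun ha hb => ⟨P.add_mem ha.1 hb.1, fun y hy => by
    rw [add_lie, ha.2 y hy, hb.2 y hy, add_zero]⟩
  smul_mem' := fun c x hx => ⟨P.smul_mem c hx.1, fun y hy => by
    rw [smul_lie, hx.2 y hy, smul_zero]⟩
  lie_mem := fun {z x} hx => ⟨P.lie_mem hx.1, fun y hy => by
    rw [lie_lie, hx.2 y hy, hx.2 _ (I.lie_mem hy), lie_zero, sub_zero]⟩

/-- If the abelian subspaces of the ideal `P` have dimension at most `n`, then `dim P` is at most
`n + n (n + 1) / 2`: enlarge an abelian ideal in `P` until it contains its centralizer. -/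
theorem LieIdeal.two_mul_finrank_le_of_abelian_finrank_le {K L : Type*} [Field K] [IsAlgClosed K]
    [LieRing L] [LieAlgebra K L] [FiniteDimensional K L]
    (N : LieIdeal K L) (hN : ∀ x y : L, ⁅x, y⁆ ∈ N)
    (hnil : ∀ x ∈ N, IsNilpotent (LieAlgebra.ad K L x)) (P : LieIdeal K L) (n : ℕ)
    (h : ∀ I : Submodule K L, I ≤ P.toSubmodule → (∀ x ∈ I, ∀ y ∈ I, ⁅x, y⁆ = 0) →
      Module.finrank K I ≤ n) :
    2 * Module.finrank K P ≤ n ^ 2 + 3 * n := by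
  let Q : Set (LieIdeal K L) := {I | I ≤ P ∧ (∀ x ∈ I, ∀ y ∈ I, ⁅x, y⁆ = 0) ∧
    2 * Module.finrank K P ≤ 2 * Module.finrank K (centralizerIn P I) +
      Module.finrank K I * (Module.finrank K I + 1)}
  have hQ : (⊥ : LieIdeal K L) ∈ Q := by
    refine ⟨bot_le, fun x hx y _ => by rw [(LieSubmodule.mem_bot x).1 hx, zero_lie], ?_⟩
    have : P ≤ centralizerIn P ⊥ := fun x hx => ⟨hx, fun y hy => by
      rw [(LieSubmodule.mem_bot y).1 hy, lie_zero]⟩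
    have := Submodule.finrank_mono ((LieSubmodule.toSubmodule_le_toSubmodule _ _).2 this)
    change 2 * Module.finrank K P.toSubmodule ≤
      2 * Module.finrank K (centralizerIn P ⊥).toSubmodule + _
    omega
  obtain ⟨I, ⟨hIP, hIab, hI⟩, hmax⟩ :=
    (wellFounded_gt (α := LieIdeal K L)).has_min Q ⟨_, hQ⟩
  have hC : centralizerIn P I ≤ I := by
    by_contra hC
    obtain ⟨x, hxC, hxI, hx⟩ := exists_lie_eigenvector_mod_ideal N hN hnil I _ hC
    let J : LieIdeal K L :=
      { I.toSubmodule ⊔ K ∙ x with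
        lie_mem := fun {y z} hz => by
          obtain ⟨u, hu, v, hv, rfl⟩ := Submodule.mem_sup.1 hz
          obtain ⟨a, rfl⟩ := Submodule.mem_span_singleton.1 hv
          obtain ⟨c, hc⟩ := hx y
          refine Submodule.mem_sup.2 ⟨⁅y, u⁆ + a • (⁅y, x⁆ - c • x),
            I.add_mem (I.lie_mem hu) (I.smul_mem a hc), (a * c) • x,
            Submodule.smul_mem _ _ (Submodule.mem_span_singleton_self x), ?_⟩
          rw [lie_add, lie_smul, smul_sub, mul_smul]
          abel }
    have hIJ' : I.toSubmodule ≤ J.toSubmodule := le_sup_left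
    have hxJ : x ∈ J := (le_sup_right : K ∙ x ≤ I.toSubmodule ⊔ K ∙ x)
      (Submodule.mem_span_singleton_self x)
    have hIJ : I < J := lt_of_le_of_ne hIJ' fun e => hxI (e ▸ hxJ)
    have hJ : ∀ z ∈ J, ∃ u ∈ I, ∃ a : K, z = u + a • x := fun z hz => by
      obtain ⟨u, hu, v, hv, rfl⟩ := Submodule.mem_sup.1 hz
      obtain ⟨a, rfl⟩ := Submodule.mem_span_singleton.1 hv
      exact ⟨u, hu, a, rfl⟩
    refine hmax J ⟨fun z hz => ?_, fun z hz w hw => ?_, ?_⟩ hIJ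
    · obtain ⟨u, hu, a, rfl⟩ := hJ z hz
      exact P.add_mem (hIP hu) (P.smul_mem a hxC.1)
    · obtain ⟨u, hu, a, rfl⟩ := hJ z hz
      obtain ⟨v, hv, b, rfl⟩ := hJ w hw
      have hux : ⁅u, x⁆ = 0 := by rw [← lie_skew, hxC.2 u hu, neg_zero]
      simp [hIab u hu v hv, hxC.2 v hv, hux]
    · let φ : centralizerIn P I →ₗ[K] J :=
        { toFun := fun b => ⟨⁅(b : L), x⁆, J.lie_mem hxJ⟩
          map_add' := fun a b => Subtype.ext (by simp)
          map_smul' := fun c b => Subtype.ext (by simp) }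
      have hker : Module.finrank K φ.ker ≤ Module.finrank K (centralizerIn P J) := by
        refine (Submodule.finrank_map_subtype_eq (centralizerIn P I).toSubmodule
          φ.ker).symm.le.trans ?_
        refine Submodule.finrank_mono (t := (centralizerIn P J).toSubmodule) ?_
        rintro _ ⟨b, hb, rfl⟩
        have hbx : ⁅(b : L), x⁆ = 0 := congrArg Subtype.val hb
        refine ⟨b.2.1, fun y hy => ?_⟩
        obtain ⟨u, hu, a, rfl⟩ := hJ y hy
        simp [b.2.2 u hu, hbx]
      have hrange : Module.finrank K φ.range ≤ Module.finrank K J := Submodule.finrank_le _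
      have hrn := φ.finrank_range_add_finrank_ker
      have hlt : Module.finrank K I < Module.finrank K J :=
        Submodule.finrank_lt_finrank_of_lt (lt_of_le_of_ne hIJ' fun e => hxI (e.ge hxJ))
      nlinarith
  have h1 : Module.finrank K (centralizerIn P I) ≤ Module.finrank K I :=
    Submodule.finrank_mono ((LieSubmodule.toSubmodule_le_toSubmodule _ _).2 hC)
  have h2 : Module.finrank K I ≤ n := h I.toSubmodule hIP hIab
  nlinarith

theorem Matrix.isNilpotent_of_strictly_upperTriangular {K : Type*} [Field K] {d : ℕ}
    (M : Matrix (Fin d) (Fin d) K) (hM : M.BlockTriangular id) (hd : ∀ k, M k k = 0) :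
    IsNilpotent M := by
  refine ⟨d, ?_⟩
  have h := Matrix.aeval_self_charpoly M
  rw [Matrix.charpoly_of_isUpperTriangular M hM] at h
  simpa [hd] using h

theorem Matrix.BlockTriangular.mul_apply_diag {K : Type*} [Field K] {d : ℕ}
    {M N : Matrix (Fin d) (Fin d) K} (hM : M.BlockTriangular id) (hN : N.BlockTriangular id)
    (k : Fin d) : (M * N) k k = M k k * N k k := by
  rw [Matrix.mul_apply]
  refine Finset.sum_eq_single k (fun j _ hj => ?_) (by simp)
  rcases lt_or_gt_of_ne hj with h | h
  · rw [hM h, zero_mul]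
  · rw [hN h, mul_zero]

/-- Wedderburn's theorem for a finite-dimensional algebra, modulo its radical. -/
theorem exists_surjective_algHom_pi_matrix (K R : Type*) [Field K] [IsAlgClosed K] [Ring R]
    [Algebra K R] [FiniteDimensional K R] :
    ∃ (m : ℕ) (d : Fin m → ℕ) (f : R →ₐ[K] Π i, Matrix (Fin (d i)) (Fin (d i)) K),
      Function.Surjective f ∧ ∀ x, f x = 0 → IsNilpotent x := by
  have : IsArtinianRing R := IsArtinianRing.of_finite K R
  obtain ⟨m, d, -, ⟨g⟩⟩ :=
    IsSemisimpleRing.exists_algEquiv_pi_matrix_of_isAlgClosed K (R ⧸ Ring.jacobson R)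
  refine ⟨m, d, g.toAlgHom.comp (Ideal.Quotient.mkₐ K (Ring.jacobson R)),
    g.surjective.comp (Ideal.Quotient.mkₐ_surjective K _), fun x hx => ?_⟩
  have hx' : x ∈ Ring.jacobson R := by
    rw [← Ideal.Quotient.eq_zero_iff_mem]
    exact g.injective (hx.trans (map_zero g).symm)
  obtain ⟨k, hk⟩ := IsSemiprimaryRing.isNilpotent (R := R)
  exact ⟨k, by simpa [hk] using Ideal.pow_mem_pow hx' k⟩

section TriangularSubalgebra

attribute [local instance] LieRing.ofAssociativeRing

variable {K R ι : Type*} [Field K] [Ring R] [Algebra K R] {d : ι → ℕ}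

/-- The elements whose image in a product of matrix algebras is upper triangular. -/
def triangularSubalgebra (f : R →ₐ[K] Π i, Matrix (Fin (d i)) (Fin (d i)) K) :
    Subalgebra K R where
  carrier := {r | ∀ i, (f r i).BlockTriangular id}
  mul_mem' ha hb i := by
    rw [map_mul]
    exact (ha i).mul (hb i)
  add_mem' ha hb i := by
    rw [map_add]
    exact (ha i).add (hb i)
  algebraMap_mem' c i := by
    rw [AlgHom.commutes, Pi.algebraMap_apply]
    exact Matrix.blockTriangular_diagonal _

/-- The elements of `triangularSubalgebra f` whose image is strictly upper triangular. -/
def strictlyTriangularIdeal (f : R →ₐ[K] Π i, Matrix (Fin (d i)) (Fin (d i)) K) :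
    LieIdeal K (triangularSubalgebra f) where
  carrier := {r | ∀ i k, f r i k k = 0}
  zero_mem' i k := by simp
  add_mem' ha hb i k := by simp [ha i k, hb i k]
  smul_mem' c x hx i k := by simp [hx i k]
  lie_mem {x y} _ i k := by
    simp [Ring.lie_def, (x.2 i).mul_apply_diag (y.2 i), (y.2 i).mul_apply_diag (x.2 i), mul_comm]

theorem lie_mem_strictlyTriangularIdeal (f : R →ₐ[K] Π i, Matrix (Fin (d i)) (Fin (d i)) K)
    (x y : triangularSubalgebra f) : ⁅x, y⁆ ∈ strictlyTriangularIdeal f := fun i k => by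
  simp [Ring.lie_def, (x.2 i).mul_apply_diag (y.2 i), (y.2 i).mul_apply_diag (x.2 i), mul_comm]

theorem isNilpotent_of_mem_strictlyTriangularIdeal [Fintype ι]
    (f : R →ₐ[K] Π i, Matrix (Fin (d i)) (Fin (d i)) K) (hf : ∀ x, f x = 0 → IsNilpotent x)
    {x : triangularSubalgebra f} (hx : x ∈ strictlyTriangularIdeal f) : IsNilpotent x := by
  have h : ∀ i, IsNilpotent (f x i) := fun i =>
    Matrix.isNilpotent_of_strictly_upperTriangular _ (x.2 i) (hx i)
  choose k hk using h
  obtain ⟨l, hl⟩ := hf ((x : R) ^ ∑ i, k i) (by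
    funext i
    rw [map_pow, Pi.pow_apply]
    exact pow_eq_zero_of_le (Finset.single_le_sum (fun _ _ => Nat.zero_le _) (Finset.mem_univ i))
      (hk i))
  exact ⟨(∑ i, k i) * l, Subtype.ext (by simpa [pow_mul] using hl)⟩

theorem finrank_le_finrank_triangularSubalgebra_add [Fintype ι] [FiniteDimensional K R]
    (f : R →ₐ[K] Π i, Matrix (Fin (d i)) (Fin (d i)) K) :
    Module.finrank K R ≤ Module.finrank K (triangularSubalgebra f) +
      ∑ i, Fintype.card {p : Fin (d i) × Fin (d i) // p.2 < p.1} := by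
  let φ : R →ₗ[K] ((Σ i, {p : Fin (d i) × Fin (d i) // p.2 < p.1}) → K) :=
    { toFun := fun r p => f r p.1 p.2.1.1 p.2.1.2
      map_add' := fun a b => by ext; simp
      map_smul' := fun c b => by ext; simp }
  have h1 := φ.finrank_range_add_finrank_ker
  have h2 := Submodule.finrank_le φ.range
  have h3 : Module.finrank K φ.ker ≤ Module.finrank K (triangularSubalgebra f) := by
    refine Submodule.finrank_mono (t := (triangularSubalgebra f).toSubmodule)
      fun r hr i a b hab => ?_
    exact congrFun hr ⟨i, (a, b), hab⟩
  rw [Module.finrank_fintype_fun_eq_card, Fintype.card_sigma] at h2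
  omega

theorem card_lower_le_two_mul (d : ℕ) :
    Fintype.card {p : Fin d × Fin d // p.2 < p.1} ≤
      2 * Fintype.card ({a : Fin d // a.1 < d / 2} × {b : Fin d // d / 2 ≤ b.1}) := by
  have h1 : Fintype.card {p : Fin d × Fin d // p.2 < p.1} = ∑ i ∈ Finset.range d, i := by
    rw [← Fin.sum_univ_eq_sum_range (fun i => i)]
    rw [Fintype.card_congr (β := Σ i : Fin d, {j : Fin d // j < i})
      ⟨fun p => ⟨p.1.1, p.1.2, p.2⟩, fun p => ⟨(p.1, p.2.1), p.2.2⟩, fun _ => rfl, fun _ => rfl⟩,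
      Fintype.card_sigma]
    refine Finset.sum_congr rfl fun i _ => ?_
    rw [Fintype.card_subtype, Finset.filter_gt_eq_Iio, Fin.card_Iio]
  have h2 : Fintype.card {a : Fin d // a.1 < d / 2} = d / 2 := by
    have e : Fintype.card {a : Fin d // a.1 < d / 2} = Fintype.card (Fin (d / 2)) :=
      Fintype.card_congr ⟨fun a => ⟨a.1, a.2⟩, fun a => ⟨⟨a, by omega⟩, a.2⟩, fun _ => rfl,
        fun _ => rfl⟩
    simpa using e
  have h3 : Fintype.card {b : Fin d // d / 2 ≤ b.1} = d - d / 2 := by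
    have e := Fintype.card_subtype_compl (fun a : Fin d => a.1 < d / 2)
    simpa [h2] using e
  rw [h1, Fintype.card_prod, h2, h3]
  have h4 := Finset.sum_range_id_mul_two d
  obtain ⟨m, rfl | rfl⟩ := d.even_or_odd'
  · rw [show 2 * m / 2 = m by omega, show 2 * m - m = m by omega]
    have : 2 * m * (2 * m - 1) ≤ 2 * m * (2 * m) := Nat.mul_le_mul_left _ (Nat.sub_le _ _)
    nlinarith
  · rw [show (2 * m + 1) / 2 = m by omega, show 2 * m + 1 - m = m + 1 by omega]
    rw [show 2 * m + 1 - 1 = 2 * m by omega] at h4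
    nlinarith

/-- The off-diagonal Peirce component `e R (1 - e)` as a linear map. -/
def peirceMap (K : Type*) {R : Type*} [Field K] [Ring R] [Algebra K R] (e : R) : R →ₗ[K] R :=
  LinearMap.mulLeft K e ∘ₗ LinearMap.mulRight K (1 - e)

theorem exists_idempotent_sum_le_finrank_peirce [Fintype ι] [FiniteDimensional K R]
    (f : R →ₐ[K] Π i, Matrix (Fin (d i)) (Fin (d i)) K) (hf : ∀ x, f x = 0 → IsNilpotent x)
    (hsurj : Function.Surjective f) :
    ∃ e : R, IsIdempotentElem e ∧
      ∑ i, Fintype.card {p : Fin (d i) × Fin (d i) // p.2 < p.1} ≤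
        2 * Module.finrank K (peirceMap K e).range := by
  let E : Π i, Matrix (Fin (d i)) (Fin (d i)) K := fun i =>
    Matrix.diagonal fun a => if a.1 < d i / 2 then 1 else 0
  obtain ⟨e, he, hfe⟩ := exists_isIdempotentElem_eq_of_ker_isNilpotent
    (f : R →+* Π i, Matrix (Fin (d i)) (Fin (d i)) K)
    (fun x hx => hf x hx) E (hsurj E) (by
      funext i
      simp [E])
  replace hfe : f e = E := hfe
  refine ⟨e, he, ?_⟩
  let T := Σ i, {a : Fin (d i) // a.1 < d i / 2} × {b : Fin (d i) // d i / 2 ≤ b.1}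
  let ψ : R →ₗ[K] (T → K) :=
    { toFun := fun r p => f r p.1 p.2.1 p.2.2
      map_add' := fun a b => by ext; simp
      map_smul' := fun c b => by ext; simp }
  have hψ : ∀ r, ψ (peirceMap K e r) = ψ r := fun r => by
    funext ⟨i, ⟨a, ha⟩, ⟨b, hb⟩⟩
    have hb' : ¬ b.1 < d i / 2 := by omega
    simp [ψ, peirceMap, hfe, E, mul_sub, ha, hb']
  have hψs : Function.Surjective (ψ ∘ₗ (peirceMap K e).range.subtype) := fun t => by
    obtain ⟨r, hr⟩ := hsurj fun i a b =>
      if h : a.1 < d i / 2 ∧ d i / 2 ≤ b.1 then t ⟨i, ⟨a, h.1⟩, ⟨b, h.2⟩⟩ else 0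
    refine ⟨⟨peirceMap K e r, r, rfl⟩, (hψ r).trans ?_⟩
    funext ⟨i, ⟨a, ha⟩, ⟨b, hb⟩⟩
    simp [ψ, hr, ha, hb]
  have h := LinearMap.finrank_le_finrank_of_surjective hψs
  rw [Module.finrank_fintype_fun_eq_card, Fintype.card_sigma] at h
  refine le_trans ?_ (Nat.mul_le_mul_left 2 h)
  rw [Finset.mul_sum]
  exact Finset.sum_le_sum fun i _ => card_lower_le_two_mul (d i)

/-- The bound for unital algebras with an augmentation `ε`, in terms of the commuting subspaces of
the augmentation ideal. -/
theorem two_mul_finrank_le_of_augmentation {K R : Type*} [Field K] [IsAlgClosed K] [Ring R]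
    [Algebra K R] [FiniteDimensional K R] (ε : R →ₐ[K] K) (n : ℕ)
    (h : ∀ I : Submodule K R, I ≤ ε.toLinearMap.ker → (∀ x ∈ I, ∀ y ∈ I, x * y = y * x) →
      Module.finrank K I ≤ n) :
    2 * Module.finrank K R ≤ n ^ 2 + 7 * n + 2 := by
  obtain ⟨m, d, f, hsurj, hf⟩ := exists_surjective_algHom_pi_matrix K R
  obtain ⟨e, he, hle⟩ := exists_idempotent_sum_le_finrank_peirce f hf hsurj
  have hcodim := finrank_le_finrank_triangularSubalgebra_add f
  have he' : (1 - e) * e = 0 := by rw [sub_mul, one_mul, he.eq, sub_self]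
  have hpeirce : Module.finrank K (peirceMap K e).range ≤ n := by
    refine h _ ?_ ?_
    · rintro _ ⟨r, rfl⟩
      have : ε (1 - e) * ε e = 0 := by rw [← map_mul, he', map_zero]
      simp only [peirceMap, LinearMap.coe_comp, Function.comp_apply, LinearMap.mulLeft_apply,
        LinearMap.mulRight_apply, LinearMap.mem_ker, AlgHom.toLinearMap_apply, map_mul]
      linear_combination ε r * this
    · have hmul : ∀ r s, peirceMap K e r * peirceMap K e s = 0 := fun r s => by
        calc e * (r * (1 - e)) * (e * (s * (1 - e)))
            = e * r * ((1 - e) * e) * (s * (1 - e)) := by noncomm_ring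
          _ = 0 := by rw [he', mul_zero, zero_mul]
      rintro _ ⟨r, rfl⟩ _ ⟨s, rfl⟩
      rw [hmul, hmul]
  let B := triangularSubalgebra f
  let φ : B →ₗ[K] K := ε.toLinearMap ∘ₗ B.val.toLinearMap
  let P : LieIdeal K B :=
    { φ.ker with
      lie_mem := fun {x y} _ => by
        change ε (x * y - y * x : R) = 0
        rw [map_sub, map_mul, map_mul, mul_comm, sub_self] }
  have hP : 2 * Module.finrank K P ≤ n ^ 2 + 3 * n := by
    refine LieIdeal.two_mul_finrank_le_of_abelian_finrank_le (strictlyTriangularIdeal f)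
      (lie_mem_strictlyTriangularIdeal f)
      (fun x hx => LieAlgebra.ad_nilpotent_of_nilpotent (R := K)
        (isNilpotent_of_mem_strictlyTriangularIdeal f hf hx)) P n fun I hI hcomm => ?_
    rw [(Submodule.equivMapOfInjective B.val.toLinearMap Subtype.val_injective I).finrank_eq]
    refine h _ ?_ ?_
    · rintro _ ⟨x, hx, rfl⟩
      exact hI hx
    · rintro _ ⟨x, hx, rfl⟩ _ ⟨y, hy, rfl⟩
      exact congrArg Subtype.val (sub_eq_zero.1 (hcomm x hx y hy))
  have h1 := φ.finrank_range_add_finrank_ker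
  have h2 : Module.finrank K φ.range ≤ 1 :=
    (Submodule.finrank_le _).trans (Module.finrank_self K).le
  have h3 : Module.finrank K φ.ker = Module.finrank K P := rfl
  have h4 : Module.finrank K B = Module.finrank K (triangularSubalgebra f) := rfl
  linarith

end TriangularSubalgebra

/-- If `A` is a finite-dimensional associative (possibly non-unital) algebra over an
algebraically closed field `K` in which every commutative (non-unital) subalgebra has
dimension at most `n`, then `2 · dim A ≤ n² + 10n`. -/
theorem dim_le_of_associative_algebra_alg_closed
    (K : Type*) [Field K] [IsAlgClosed K] (A : Type*) [NonUnitalRing A] [Module K A]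
    [SMulCommClass K A A] [IsScalarTower K A A] [FiniteDimensional K A] (n : ℕ)
    (hA : ∀ S : NonUnitalSubalgebra K A, (∀ x ∈ S, ∀ y ∈ S, x * y = y * x) →
      Module.finrank K S ≤ n) :
    2 * Module.finrank K A ≤ n ^ 2 + 10 * n := by
  let e : Unitization K A ≃ₗ[K] K × A := Unitization.linearEquiv K K A
  have : FiniteDimensional K (Unitization K A) := Module.Finite.equiv e.symm
  have hdim : Module.finrank K (Unitization K A) = 1 + Module.finrank K A := by
    rw [e.finrank_eq, Module.finrank_prod, Module.finrank_self]
  have h := two_mul_finrank_le_of_augmentation (Unitization.fstHom K A) n fun I hI hcomm => by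
    let ι : A →ₗ[K] Unitization K A := Unitization.inrHom K K A
    let J : Submodule K A := I.comap ι
    have hIJ : I ≤ J.map ι := fun x hx => by
      have hx' : ι x.snd = x := Unitization.toProd_injective (Prod.ext (hI hx).symm rfl)
      exact ⟨x.snd, by rwa [SetLike.mem_coe, Submodule.mem_comap, hx'], hx'⟩
    have hJ : ∀ a ∈ (J : Set A), ∀ b ∈ (J : Set A), a * b = b * a := fun a ha b hb =>
      Unitization.inr_injective (R := K) (by
        rw [Unitization.inr_mul, Unitization.inr_mul]
        exact hcomm _ ha _ hb)
    have := NonUnitalAlgebra.isMulCommutative_adjoin K hJ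
    calc Module.finrank K I ≤ Module.finrank K (J.map ι) := Submodule.finrank_mono hIJ
      _ ≤ Module.finrank K J := Submodule.finrank_map_le ι J
      _ ≤ Module.finrank K (NonUnitalAlgebra.adjoin K (J : Set A)) :=
        Submodule.finrank_mono (t := (NonUnitalAlgebra.adjoin K (J : Set A)).toSubmodule)
          (NonUnitalAlgebra.subset_adjoin K)
      _ ≤ n := hA _ fun x hx y hy => congrArg Subtype.val
        (mul_comm' (⟨x, hx⟩ : NonUnitalAlgebra.adjoin K (J : Set A)) ⟨y, hy⟩)
  linarith
end

section
/- Let K be a field of characteristic 0 and let A be a finite-dimensional unital associative algebra over K such that every commutative unital subalgebra of A (a unital K-subalgebra on which multiplication is commutative) has dimension at most n. Then 2 · dim A ≤ 3n² + n. -/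
open Module Polynomial

/-- A subspace `C` stable under commutators with a nilpotent ideal `J` and not contained in `I`
contains a vector outside `I` whose commutators with `J` all lie in `I`. -/
theorem exists_notMem_forall_commutator_mem {K A : Type*} [Field K] [Ring A] [Algebra K A]
    (J : Ideal A) [J.IsTwoSided] (hJ : IsNilpotent J) (I C : Submodule K A)
    (hC : ∀ a ∈ J, ∀ x ∈ C, a * x - x * a ∈ C) (hCI : ¬ C ≤ I) :
    ∃ v ∈ C, v ∉ I ∧ ∀ a ∈ J, a * v - v * a ∈ I := by
  classical
  have hex : ∃ k, ∀ x ∈ C, x ∈ J ^ k → x ∈ I := by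
    obtain ⟨k, hk⟩ := hJ
    refine ⟨k, fun x _ hx => ?_⟩
    rw [hk] at hx
    have hx0 : x = 0 := by simpa using hx
    exact hx0 ▸ I.zero_mem
  have hspec := Nat.find_spec hex
  have hmin := fun {m} => Nat.find_min (H := hex) (m := m)
  generalize Nat.find hex = k at hspec hmin
  cases k with
  | zero => exact absurd (fun x hx => hspec x hx (by simp [Submodule.pow_zero])) hCI
  | succ k =>
    have h := hmin (Nat.lt_succ_self k)
    push Not at h
    obtain ⟨v, hvC, hvk, hvI⟩ := h
    refine ⟨v, hvC, hvI, fun a ha => hspec _ (hC a ha v hvC) (sub_mem ?_ ?_)⟩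
    · rw [Ideal.IsTwoSided.pow_succ]
      exact Ideal.mul_mem_mul ha hvk
    · rw [Submodule.pow_succ]
      exact Ideal.mul_mem_mul hvk ha

/-- If every commutative unital subalgebra has dimension at most `n`, then every nilpotent
two-sided ideal has dimension at most `n (n + 1) / 2`. -/
theorem two_mul_finrank_le_of_isNilpotent {K A : Type*} [Field K] [Ring A] [Algebra K A]
    [FiniteDimensional K A] (n : ℕ)
    (hA : ∀ S : Subalgebra K A, (∀ x ∈ S, ∀ y ∈ S, x * y = y * x) → finrank K S ≤ n)
    (J : Ideal A) [J.IsTwoSided] (hJ : IsNilpotent J) :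
    2 * finrank K (J.restrictScalars K) ≤ n ^ 2 + n := by
  let cent : Submodule K A → Submodule K A := fun I =>
    J.restrictScalars K ⊓ Subalgebra.toSubmodule (Subalgebra.centralizer K (I : Set A))
  have mem_cent : ∀ I x, x ∈ cent I ↔ x ∈ J ∧ ∀ y ∈ I, y * x = x * y := fun I x => by
    simp [cent, Subalgebra.mem_centralizer_iff]
  let P : Set (Submodule K A) := {I | I ≤ J.restrictScalars K ∧
    (∀ a ∈ J, ∀ x ∈ I, a * x - x * a ∈ I) ∧ (∀ x ∈ I, ∀ y ∈ I, x * y = y * x) ∧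
    2 * finrank K (J.restrictScalars K) + finrank K I ≤
      2 * finrank K (cent I) + finrank K I * finrank K I}
  have hbot : (⊥ : Submodule K A) ∈ P := by
    refine ⟨bot_le, by simp, by simp, ?_⟩
    have : cent ⊥ = J.restrictScalars K := by
      ext x
      simp [mem_cent]
    rw [this]
    simp
  obtain ⟨I, ⟨hIJ, hIstable, hIcomm, hIdim⟩, hImax⟩ :=
    (wellFounded_gt (α := Submodule K A)).has_min P ⟨⊥, hbot⟩
  have hI_le : I ≤ cent I := fun x hx => (mem_cent _ _).2 ⟨hIJ hx, fun y hy => hIcomm y hy x hx⟩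
  have hcent_le : cent I ≤ I := by
    by_contra hnot
    have hstable : ∀ a ∈ J, ∀ x ∈ cent I, a * x - x * a ∈ cent I := by
      intro a ha x hx
      obtain ⟨hxJ, hxc⟩ := (mem_cent _ _).1 hx
      refine (mem_cent _ _).2 ⟨sub_mem (J.mul_mem_left _ hxJ) (J.mul_mem_left _ ha), ?_⟩
      intro y hy
      have h1 := hxc _ (hIstable a ha y hy)
      have h2 := hxc y hy
      have h3 : y * a * x - a * y * x = x * y * a - x * a * y := by
        have := congrArg Neg.neg h1
        simpa [sub_mul, mul_sub, mul_assoc] using this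
      have h4 : a * x * y = a * y * x := by rw [mul_assoc, ← h2, mul_assoc]
      calc y * (a * x - x * a) = y * a * x - y * x * a := by noncomm_ring
        _ = (y * a * x - a * y * x) + a * y * x - y * x * a := by noncomm_ring
        _ = (a * x - x * a) * y := by rw [h3, ← h4, h2]; noncomm_ring
    obtain ⟨v, hv, hvI, hvcomm⟩ :=
      exists_notMem_forall_commutator_mem J hJ I (cent I) hstable hnot
    have mem_sup : ∀ x ∈ I ⊔ K ∙ v, ∃ i ∈ I, ∃ c : K, i + c • v = x := fun x hx => by
      simpa [Submodule.mem_sup, Submodule.mem_span_singleton] using hx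
    obtain ⟨hvJ, hvc⟩ := (mem_cent _ _).1 hv
    have hlt : I < I ⊔ K ∙ v := by
      refine lt_of_le_of_ne le_sup_left fun h => hvI ?_
      rw [h]
      exact Submodule.mem_sup_right (Submodule.mem_span_singleton_self v)
    refine hImax (I ⊔ K ∙ v) ⟨?_, ?_, ?_, ?_⟩ hlt
    · refine sup_le hIJ ?_
      rw [Submodule.span_singleton_le_iff_mem]
      exact hvJ
    · intro a ha x hx
      obtain ⟨i, hi, c, rfl⟩ := mem_sup _ hx
      have : a * (i + c • v) - (i + c • v) * a = (a * i - i * a) + c • (a * v - v * a) := by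
        rw [mul_add, add_mul, mul_smul_comm, smul_mul_assoc, smul_sub]
        abel
      rw [this]
      exact Submodule.mem_sup_left
        (I.add_mem (hIstable a ha i hi) (I.smul_mem c (hvcomm a ha)))
    · intro x hx y hy
      obtain ⟨i, hi, c, rfl⟩ := mem_sup _ hx
      obtain ⟨j, hj, d, rfl⟩ := mem_sup _ hy
      simp only [mul_add, add_mul, mul_smul_comm, smul_mul_assoc, smul_add]
      rw [hIcomm i hi j hj, hvc i hi, hvc j hj, smul_comm c d]
      abel
    · have hdim : finrank K ↥(I ⊔ K ∙ v) = finrank K I + 1 := by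
        rw [Submodule.finrank_sup_span_singleton hvI]
      let f : cent I →ₗ[K] I :=
        { toFun := fun y => ⟨y * v - v * y, hvcomm y ((mem_cent _ _).1 y.2).1⟩
          map_add' := fun x y => by
            ext
            simp [add_mul, mul_add]
            abel
          map_smul' := fun c x => by
            ext
            simp [smul_sub] }
      have hker : finrank K (LinearMap.ker f) ≤ finrank K (cent (I ⊔ K ∙ v)) := by
        rw [← Submodule.finrank_map_subtype_eq]
        refine Submodule.finrank_mono ?_
        rintro _ ⟨y, hy, rfl⟩
        obtain ⟨hyJ, hyc⟩ := (mem_cent _ _).1 y.2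
        have hyv : (y : A) * v - v * y = 0 := congrArg Subtype.val (LinearMap.mem_ker.1 hy)
        refine (mem_cent _ _).2 ⟨hyJ, fun z hz => ?_⟩
        obtain ⟨i, hi, c, rfl⟩ := mem_sup _ hz
        simp only [Submodule.subtype_apply, mul_add, add_mul, mul_smul_comm, smul_mul_assoc]
        rw [hyc i hi, sub_eq_zero.1 hyv]
      have hrange : finrank K (LinearMap.range f) ≤ finrank K I := Submodule.finrank_le _
      have hsum := LinearMap.finrank_range_add_finrank_ker f
      rw [hdim]
      nlinarith
  have hcent : cent I = I := le_antisymm hcent_le hI_le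
  have hIn : finrank K I ≤ n := by
    have := Algebra.isMulCommutative_adjoin K hIcomm
    refine le_trans ?_ (hA (Algebra.adjoin K (I : Set A)) fun x hx y hy => ?_)
    · exact Submodule.finrank_mono (t := Subalgebra.toSubmodule (Algebra.adjoin K (I : Set A)))
        fun x hx => Algebra.subset_adjoin hx
    · exact congrArg Subtype.val (mul_comm' (⟨x, hx⟩ : Algebra.adjoin K (I : Set A)) ⟨y, hy⟩)
  rw [hcent] at hIdim
  nlinarith

/-- The dimension of a division algebra is at most the square of the dimension of any subalgebra
containing its own centralizer. -/
theorem finrank_le_sq_of_centralizer_le {K D : Type*} [Field K] [DivisionRing D] [Algebra K D]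
    [FiniteDimensional K D] (L : Subalgebra K D)
    (hL : ∀ y, (∀ l ∈ L, l * y = y * l) → y ∈ L) : finrank K D ≤ finrank K L ^ 2 := by
  let _ : DivisionRing L := divisionRingOfFiniteDimensional K L
  have : Module.Finite L D := Module.Finite.of_restrictScalars_finite K L D
  let b := Module.finBasis L D
  have key : ∀ (s : Finset (Fin (finrank L D))) (c : Fin (finrank L D) → D),
      (∀ l ∈ L, ∑ j ∈ s, c j * (l * b j) = 0) → ∀ j ∈ s, c j = 0 := by
    intro s
    induction s using Finset.induction_on with
    | empty => simp
    | insert a s ha ih =>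
      intro c hc
      by_cases hca : c a = 0
      · have h := ih c fun l hl => by simpa [Finset.sum_insert ha, hca] using hc l hl
        intro j hj
        rcases Finset.mem_insert.1 hj with rfl | hj
        · exact hca
        · exact h j hj
      exfalso
      let e : Fin (finrank L D) → D := fun j => (c a)⁻¹ * c j
      have he : ∀ l ∈ L, ∑ j ∈ insert a s, e j * (l * b j) = 0 := fun l hl => by
        simp only [e, mul_assoc]
        rw [← Finset.mul_sum, hc l hl, mul_zero]
      have hea : e a = 1 := inv_mul_cancel₀ hca
      have hcomm : ∀ m ∈ L, ∀ j ∈ s, m * e j - e j * m = 0 := by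
        intro m hm
        refine ih (fun j => m * e j - e j * m) fun l hl => ?_
        have h1 : ∑ j ∈ insert a s, (m * e j - e j * m) * (l * b j) = 0 := by
          have h2 := he (m * l) (mul_mem hm hl)
          simp only [sub_mul, Finset.sum_sub_distrib, mul_assoc] at h2 ⊢
          rw [h2, ← Finset.mul_sum, he l hl, mul_zero, sub_zero]
        simpa [Finset.sum_insert ha, hea] using h1
      have heL : ∀ j ∈ insert a s, e j ∈ L := by
        intro j hj
        rcases Finset.mem_insert.1 hj with rfl | hj
        · rw [hea]
          exact one_mem L
        · exact hL _ fun m hm => sub_eq_zero.1 (hcomm m hm j hj)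
      classical
      let g : Fin (finrank L D) → L := fun j => if h : e j ∈ L then ⟨e j, h⟩ else 0
      have hsum : ∑ j ∈ insert a s, g j • b j = 0 := by
        rw [← he 1 (one_mem L)]
        refine Finset.sum_congr rfl fun j hj => ?_
        simp [g, heL j hj, Subalgebra.smul_def]
      have h0 := linearIndependent_iff'.1 b.linearIndependent _ g hsum a
        (Finset.mem_insert_self a s)
      have : e a = 0 := by
        simpa [g, heL a (Finset.mem_insert_self a s)] using congrArg Subtype.val h0
      rw [hea] at this
      exact one_ne_zero this
  let φ : Fin (finrank L D) → (L →ₗ[K] D) := fun j =>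
    (LinearMap.mulRight K (b j)).comp L.val.toLinearMap
  have hφ : LinearIndependent D φ := by
    rw [linearIndependent_iff']
    intro s c hc
    refine key s c fun l hl => ?_
    simpa [φ] using LinearMap.congr_fun hc ⟨l, hl⟩
  have : Module.Finite D (L →ₗ[K] D) := Module.Finite.of_restrictScalars_finite K D (L →ₗ[K] D)
  have hle := hφ.fintype_card_le_finrank
  rw [Fintype.card_fin, Module.finrank_linearMap K D L D, Module.finrank_self, mul_one] at hle
  rw [← Module.finrank_mul_finrank K L D, sq]
  exact Nat.mul_le_mul_left _ hle

/-- The degree of an element is at most the dimension of any subalgebra containing it. -/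
theorem natDegree_minpoly_le_finrank {K A : Type*} [Field K] [Ring A] [Algebra K A]
    [FiniteDimensional K A] (x : A) (S : Subalgebra K A) (hx : x ∈ S) :
    (minpoly K x).natDegree ≤ finrank K S := by
  have hli : LinearIndependent K fun i : Fin (minpoly K x).natDegree => (⟨x, hx⟩ : S) ^ (i : ℕ) :=
    LinearIndependent.of_comp S.val.toLinearMap (by
      simpa [Function.comp_def] using linearIndependent_pow (K := K) x)
  simpa using hli.fintype_card_le_finrank

/-- A finite-dimensional division algebra over a perfect field contains an element whose degree
has square at least the dimension of the algebra. -/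
theorem exists_finrank_le_natDegree_minpoly_sq (K D : Type*) [Field K] [PerfectField K]
    [DivisionRing D] [Algebra K D] [FiniteDimensional K D] :
    ∃ x : D, finrank K D ≤ (minpoly K x).natDegree ^ 2 := by
  have hbdd : BddAbove (Set.range fun x : D => (minpoly K x).natDegree) := by
    refine ⟨finrank K (⊤ : Subalgebra K D), ?_⟩
    rintro _ ⟨x, rfl⟩
    exact natDegree_minpoly_le_finrank x ⊤ trivial
  obtain ⟨x, hx⟩ := Nat.sSup_mem (Set.range_nonempty _) hbdd
  have hmax : ∀ y : D, (minpoly K y).natDegree ≤ (minpoly K x).natDegree := fun y =>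
    (le_csSup hbdd ⟨y, rfl⟩).trans hx.ge
  have hself : ∀ y, x * y = y * x → ∃ S : Subalgebra K D, x ∈ S ∧ y ∈ S ∧
      finrank K S ≤ (minpoly K x).natDegree := by
    intro y hxy
    have hmul : IsMulCommutative (Algebra.adjoin K {x, y}) := by
      refine Algebra.isMulCommutative_adjoin K ?_
      rintro _ (rfl | rfl) _ (rfl | rfl) <;> simp [hxy]
    refine ⟨Algebra.adjoin K {x, y}, Algebra.subset_adjoin (by simp),
      Algebra.subset_adjoin (by simp), ?_⟩
    let _ : Field (Algebra.adjoin K {x, y}) :=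
      { divisionRingOfFiniteDimensional K (Algebra.adjoin K {x, y}) with
        mul_comm := mul_comm' }
    obtain ⟨α, hα⟩ := Field.exists_primitive_element K (Algebra.adjoin K {x, y})
    rw [Field.primitive_element_iff_minpoly_natDegree_eq] at hα
    rw [← hα, ← minpoly.algHom_eq (Algebra.adjoin K {x, y}).val Subtype.val_injective α]
    exact hmax _
  refine ⟨x, ?_⟩
  obtain ⟨S, hxS, -, hS⟩ := hself x rfl
  have hadj : finrank K (Algebra.adjoin K {x}) = (minpoly K x).natDegree :=
    le_antisymm ((Submodule.finrank_mono
      (Subalgebra.toSubmodule.monotone (Algebra.adjoin_le (by simpa using hxS)))).trans hS)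
      (natDegree_minpoly_le_finrank x _ (Algebra.self_mem_adjoin_singleton K x))
  rw [← hadj]
  refine finrank_le_sq_of_centralizer_le _ fun y hy => ?_
  obtain ⟨S, hxS, hyS, hS⟩ := hself y (hy x (Algebra.self_mem_adjoin_singleton K x))
  have hle : Algebra.adjoin K {x} ≤ S := Algebra.adjoin_le (by simpa using hxS)
  rw [Subalgebra.eq_of_le_of_finrank_le hle (hS.trans hadj.ge)]
  exact hyS

theorem natDegree_minpoly_le_add_algebraMap {K A : Type*} [Field K] [Ring A] [Algebra K A]
    [FiniteDimensional K A] (x : A) (c : K) :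
    (minpoly K x).natDegree ≤ (minpoly K (x + algebraMap K A c)).natDegree := by
  have h0 : minpoly K (x + algebraMap K A c) ≠ 0 := minpoly.ne_zero (IsIntegral.of_finite K _)
  have hdvd : minpoly K x ∣ (minpoly K (x + algebraMap K A c)).comp (X + C c) :=
    minpoly.dvd K x (by simp [aeval_comp])
  have hle := natDegree_le_of_dvd hdvd (by simpa [comp_X_add_C_eq_zero_iff] using h0)
  simpa [natDegree_comp] using hle

theorem exists_aeval_add_algebraMap_ne_zero {K D : Type*} [Field K] [Infinite K] [Ring D]
    [IsDomain D] [Algebra K D] (x : D) {p : K[X]} (hp : p ≠ 0) :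
    ∃ c : K, aeval (x + algebraMap K D c) p ≠ 0 := by
  by_contra! h
  let S := Algebra.adjoin K {x}
  let y : S := ⟨x, Algebra.self_mem_adjoin_singleton K x⟩
  refine hp ((Polynomial.map_eq_zero_iff (algebraMap K S).injective).1
    (eq_zero_of_infinite_isRoot _ (Set.infinite_of_injective_forall_mem
      (f := fun c : K => y + algebraMap K S c) ?_ ?_)))
  · exact fun a b hab => (algebraMap K S).injective (add_left_cancel hab)
  · intro c
    have hval : S.val (aeval (y + algebraMap K S c) p) = 0 := by
      rw [← aeval_algHom_apply]
      exact h c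
    simpa [IsRoot, eval_map_algebraMap] using hval

/-- Elements of finitely many division algebras can be shifted by scalars so that their minimal
polynomials become pairwise coprime. -/
theorem exists_pairwise_isCoprime_minpoly_add {K ι : Type*} [Field K] [Infinite K] (E : ι → Type*)
    [∀ i, DivisionRing (E i)] [∀ i, Algebra K (E i)] [∀ i, FiniteDimensional K (E i)]
    (x : ∀ i, E i) (s : Finset ι) :
    ∃ c : ι → K, (s : Set ι).Pairwise
      (Function.onFun IsCoprime fun i => minpoly K (x i + algebraMap K (E i) (c i))) := by
  classical
  induction s using Finset.induction_on with
  | empty => exact ⟨0, by simp⟩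
  | insert a s ha ih =>
    obtain ⟨c, hc⟩ := ih
    obtain ⟨t, ht⟩ := exists_aeval_add_algebraMap_ne_zero (x a)
      (p := ∏ i ∈ s, minpoly K (x i + algebraMap K (E i) (c i)))
      (Finset.prod_ne_zero_iff.2 fun i _ => minpoly.ne_zero (IsIntegral.of_finite K _))
    have hcop : ∀ i ∈ s, IsCoprime (minpoly K (x a + algebraMap K (E a) t))
        (minpoly K (x i + algebraMap K (E i) (c i))) := by
      refine fun i hi => (minpoly.irreducible (IsIntegral.of_finite K _)).coprime_iff_not_dvd.2
        fun hdvd => ht ?_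
      obtain ⟨q, hq⟩ := hdvd.trans (Finset.dvd_prod_of_mem
        (fun i => minpoly K (x i + algebraMap K (E i) (c i))) hi)
      rw [hq, map_mul, minpoly.aeval, zero_mul]
    have hne : ∀ i ∈ s, i ≠ a := fun i hi h => ha (h ▸ hi)
    refine ⟨Function.update c a t, ?_⟩
    intro i hi j hj hij
    simp only [Finset.coe_insert, Set.mem_insert_iff, Finset.mem_coe] at hi hj
    rcases hi with rfl | hi <;> rcases hj with rfl | hj
    · exact absurd rfl hij
    · simpa [Function.onFun, Function.update_of_ne (hne j hj)] using hcop j hj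
    · simpa [Function.onFun, Function.update_of_ne (hne i hi)] using (hcop i hi).symm
    · simpa [Function.onFun, Function.update_of_ne (hne i hi), Function.update_of_ne (hne j hj)]
        using hc hi hj hij

/-- A finite-dimensional semisimple algebra over an infinite perfect field contains an element
whose degree has square at least the dimension of the algebra. -/
theorem IsSemisimpleRing.exists_finrank_le_natDegree_minpoly_sq (K B : Type*) [Field K]
    [PerfectField K] [Infinite K] [Ring B] [Algebra K B] [FiniteDimensional K B]
    [IsSemisimpleRing B] : ∃ x : B, finrank K B ≤ (minpoly K x).natDegree ^ 2 := by
  obtain ⟨n, D, d, _, _, _, -, ⟨e⟩⟩ :=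
    IsSemisimpleRing.exists_algEquiv_pi_matrix_divisionRing_finite K B
  choose x hx using fun i => _root_.exists_finrank_le_natDegree_minpoly_sq K (D i)
  obtain ⟨c, hc⟩ := exists_pairwise_isCoprime_minpoly_add (K := K)
    (fun s : Σ i, Fin (d i) => D s.1) (fun s => x s.1) Finset.univ
  let y : ∀ s : Σ i, Fin (d i), D s.1 := fun s => x s.1 + algebraMap K (D s.1) (c s)
  let z : ∀ i, Matrix (Fin (d i)) (Fin (d i)) (D i) := fun i => Matrix.diagonal fun j => y ⟨i, j⟩
  have hdvd : ∏ s, minpoly K (y s) ∣ minpoly K z := by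
    refine Finset.prod_dvd_of_coprime hc fun s _ => minpoly.dvd K _ ?_
    have h1 : aeval (z s.1) (minpoly K z) = 0 := by
      rw [← aeval_pi_apply₂, minpoly.aeval]
      rfl
    have h2 : z s.1 = Matrix.diagonalAlgHom K fun j => y ⟨s.1, j⟩ := rfl
    rw [h2, aeval_algHom_apply] at h1
    have h3 := congrFun (congrFun h1 s.2) s.2
    simpa [aeval_pi_apply₂] using h3
  have hdeg : ∑ i, d i * (minpoly K (x i)).natDegree ≤ (minpoly K z).natDegree := by
    refine le_trans ?_ (natDegree_le_of_dvd hdvd (minpoly.ne_zero (IsIntegral.of_finite K _)))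
    rw [natDegree_prod _ _ fun s _ => minpoly.ne_zero (IsIntegral.of_finite K _),
      Fintype.sum_sigma]
    refine Finset.sum_le_sum fun i _ => ?_
    calc d i * (minpoly K (x i)).natDegree = ∑ _j : Fin (d i), (minpoly K (x i)).natDegree := by
          simp
      _ ≤ _ := Finset.sum_le_sum fun j _ => natDegree_minpoly_le_add_algebraMap (x i) (c ⟨i, j⟩)
  refine ⟨e.symm z, ?_⟩
  rw [minpoly.algEquiv_eq, e.toLinearEquiv.finrank_eq, finrank_pi_fintype]
  calc ∑ i, finrank K (Matrix (Fin (d i)) (Fin (d i)) (D i))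
      ≤ ∑ i, (d i * (minpoly K (x i)).natDegree) ^ 2 := by
        refine Finset.sum_le_sum fun i _ => ?_
        rw [finrank_matrix, Fintype.card_fin, mul_pow, sq (d i)]
        exact Nat.mul_le_mul_left _ (hx i)
    _ ≤ (∑ i, d i * (minpoly K (x i)).natDegree) ^ 2 :=
        Finset.sum_sq_le_sq_sum_of_nonneg fun _ _ => Nat.zero_le _
    _ ≤ _ := Nat.pow_le_pow_left hdeg 2

/-- If `A` is a finite-dimensional unital associative algebra over a field `K` of
characteristic `0` in which every commutative unital subalgebra has dimension at most `n`,
then `2 · dim A ≤ 3n² + n`. -/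
theorem dim_le_of_unital_associative_algebra_char_zero
    (K : Type*) [Field K] [CharZero K] (A : Type*) [Ring A] [Algebra K A]
    [FiniteDimensional K A] (n : ℕ)
    (hA : ∀ S : Subalgebra K A, (∀ x ∈ S, ∀ y ∈ S, x * y = y * x) →
      Module.finrank K S ≤ n) :
    2 * Module.finrank K A ≤ 3 * n ^ 2 + n := by
  have : IsArtinianRing A := IsArtinianRing.of_finite K A
  let J := Ring.jacobson A
  have hJ := two_mul_finrank_le_of_isNilpotent n hA J IsSemiprimaryRing.isNilpotent
  have hsum := Submodule.finrank_quotient_add_finrank (J.restrictScalars K)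
  have hquot : finrank K (A ⧸ J.restrictScalars K) = finrank K (A ⧸ J) := rfl
  obtain ⟨b, hb⟩ := IsSemisimpleRing.exists_finrank_le_natDegree_minpoly_sq K (A ⧸ J)
  obtain ⟨a, rfl⟩ := Ideal.Quotient.mk_surjective b
  have hdeg : (minpoly K (Ideal.Quotient.mk J a)).natDegree ≤ n := by
    have hdvd : minpoly K (Ideal.Quotient.mk J a) ∣ minpoly K a := by
      refine minpoly.dvd K _ ?_
      have h := aeval_algHom_apply (Ideal.Quotient.mkₐ K J) a (minpoly K a)
      rwa [minpoly.aeval, map_zero] at h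
    refine (natDegree_le_of_dvd hdvd (minpoly.ne_zero (IsIntegral.of_finite K _))).trans ?_
    refine (natDegree_minpoly_le_finrank a _ (Algebra.self_mem_adjoin_singleton K a)).trans
      (hA _ fun x hx y hy => ?_)
    exact congrArg Subtype.val (mul_comm' (⟨x, hx⟩ : Algebra.adjoin K {a}) ⟨y, hy⟩)
  have hsq := Nat.pow_le_pow_left hdeg 2
  omega
end

section
/- Let K be a field, let k, t, n be positive integers with 2n < t(k−1), and let V be an n-dimensional vector space over K. Then there exist alternating bilinear forms φ₁, …, φ_t on V (i.e. φᵢ(v, v) = 0 for all v ∈ V) such that no k-dimensional linear subspace W ⊆ V is simultaneously isotropic for all the forms, i.e. for every subspace W of dimension k there exist an index i and vectors x, y ∈ W with φᵢ(x, y) ≠ 0. -/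
open Module

/-- The pairs `(i, j)` of indices with `i < j`. -/
abbrev IncPair (n : ℕ) : Type := {p : Fin n × Fin n // p.1 < p.2}

/-- The increasing pairs of indices that do not lie inside `S`. -/
abbrev OuterPair {n : ℕ} (S : Finset (Fin n)) : Type :=
  {p : IncPair n // ¬(p.1.1 ∈ S ∧ p.1.2 ∈ S)}

theorem sum_sum_mul_of_alternating {n : ℕ} {R : Type*} [CommRing R] (c : Fin n → Fin n → R)
    (hc : ∀ i, c i i = 0) (hc' : ∀ i j, c j i = -c i j) (x y : Fin n → R) :
    ∑ i, ∑ j, x i * y j * c i j =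
      ∑ p : IncPair n, c p.1.1 p.1.2 * (x p.1.1 * y p.1.2 - x p.1.2 * y p.1.1) := by
  have hsplit : ∀ i j, x i * y j * c i j =
      (if i < j then x i * y j * c i j else 0) + (if j < i then x i * y j * c i j else 0) := by
    intro i j
    rcases lt_trichotomy i j with h | rfl | h
    · simp [h, h.not_gt]
    · simp [hc]
    · simp [h, h.not_gt]
  have hswap : ∑ i, ∑ j, (if j < i then x i * y j * c i j else 0) =
      ∑ i, ∑ j, (if i < j then x j * y i * c j i else 0) := Finset.sum_comm
  rw [← Finset.sum_subtype (Finset.univ.filter fun p : Fin n × Fin n => p.1 < p.2) (by simp)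
    fun p => c p.1 p.2 * (x p.1 * y p.2 - x p.2 * y p.1), Finset.sum_filter,
    Fintype.sum_prod_type]
  rw [Finset.sum_congr rfl fun i _ => Finset.sum_congr rfl fun j _ => hsplit i j]
  simp_rw [Finset.sum_add_distrib]
  rw [hswap]
  simp_rw [← Finset.sum_add_distrib]
  refine Finset.sum_congr rfl fun i _ => Finset.sum_congr rfl fun j _ => ?_
  split_ifs
  · rw [hc' i j]; ring
  · ring

section Forms

variable {K V : Type*} [Field K] [AddCommGroup V] [Module K V] {n : ℕ}

/-- The alternating form with prescribed values on the increasing pairs of basis vectors. -/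
noncomputable def altForm (b : Basis (Fin n) K V) (d : IncPair n → K) : V →ₗ[K] V →ₗ[K] K :=
  ∑ p, d p • ((LinearMap.mul K K).compl₁₂ (b.coord p.1.1) (b.coord p.1.2) -
    (LinearMap.mul K K).compl₁₂ (b.coord p.1.2) (b.coord p.1.1))

theorem altForm_apply (b : Basis (Fin n) K V) (d : IncPair n → K) (x y : V) :
    altForm b d x y = ∑ p, d p * (b.repr x p.1.1 * b.repr y p.1.2 -
      b.repr x p.1.2 * b.repr y p.1.1) := by
  simp [altForm, LinearMap.sum_apply]

theorem altForm_self (b : Basis (Fin n) K V) (d : IncPair n → K) (x : V) :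
    altForm b d x x = 0 := by
  rw [altForm_apply]
  exact Finset.sum_eq_zero fun p _ => by ring

theorem altForm_swap (b : Basis (Fin n) K V) (d : IncPair n → K) (x y : V) :
    altForm b d y x = -altForm b d x y := by
  rw [altForm_apply, altForm_apply, ← Finset.sum_neg_distrib]
  exact Finset.sum_congr rfl fun p _ => by ring

theorem altForm_basis (b : Basis (Fin n) K V) (d : IncPair n → K) (p : IncPair n) :
    altForm b d (b p.1.1) (b p.1.2) = d p := by
  rw [altForm_apply, Finset.sum_eq_single p]
  · simp [p.2.ne, p.2.ne']
  · rintro ⟨⟨i, j⟩, hij⟩ - hne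
    obtain ⟨⟨k, l⟩, hkl⟩ := p
    simp only [ne_eq, Subtype.mk.injEq, Prod.mk.injEq, not_and] at hne hij hkl
    have h₁ : ¬(k = i ∧ l = j) := fun h => hne h.1.symm h.2.symm
    have h₂ : ¬(k = j ∧ l = i) := by rintro ⟨rfl, rfl⟩; exact hij.not_gt hkl
    simp only [Basis.repr_self, Finsupp.single_apply]
    grind
  · simp

end Forms

/-- The coordinate matrix of the basis change attached to `S` and the parameters `a`. -/
def shear {n : ℕ} {R : Type*} [CommRing R] (S : Finset (Fin n)) (a : Fin n × S → R)
    (r i : Fin n) : R :=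
  (if r = i then 1 else 0) - if h : i ∈ S then (if r ∈ S then 0 else a (r, ⟨i, h⟩)) else 0

/-- The coefficients of the form which has the coefficients `c` in the basis dual to the
rows of `shear S a`. -/
def shearCoeffs {n : ℕ} {R : Type*} [CommRing R] (S : Finset (Fin n)) (a : Fin n × S → R)
    (c : OuterPair S → R) (p : IncPair n) : R :=
  ∑ q : OuterPair S, c q * (shear S a q.1.1.1 p.1.1 * shear S a q.1.1.2 p.1.2 -
    shear S a q.1.1.2 p.1.1 * shear S a q.1.1.1 p.1.2)

theorem map_shear {n : ℕ} {R R' : Type*} [CommRing R] [CommRing R'] (f : R →+* R')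
    (S : Finset (Fin n)) (a : Fin n × S → R) (r i : Fin n) :
    f (shear S a r i) = shear S (fun x => f (a x)) r i := by
  unfold shear
  split_ifs <;> simp

theorem map_shearCoeffs {n : ℕ} {R R' : Type*} [CommRing R] [CommRing R'] (f : R →+* R')
    (S : Finset (Fin n)) (a : Fin n × S → R) (c : OuterPair S → R) (p : IncPair n) :
    f (shearCoeffs S a c p) = shearCoeffs S (fun x => f (a x)) (fun x => f (c x)) p := by
  simp [shearCoeffs, map_shear]

theorem card_incPair {n k : ℕ} {S : Finset (Fin n)} (hS : S.card = k) :
    2 * Fintype.card (IncPair n) = 2 * Fintype.card (OuterPair S) + k * (k - 1) := by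
  have hinner : 2 * Fintype.card {p : IncPair n // p.1.1 ∈ S ∧ p.1.2 ∈ S} = k * (k - 1) := by
    have e : Fintype.card {p : IncPair n // p.1.1 ∈ S ∧ p.1.2 ∈ S} =
        (S.offDiag.filter fun p => p.1 < p.2).card := by
      rw [← Fintype.card_coe]
      refine Fintype.card_congr ((Equiv.subtypeSubtypeEquivSubtypeInter
        (fun p : Fin n × Fin n => p.1 < p.2) fun p => p.1 ∈ S ∧ p.2 ∈ S).trans
        (Equiv.subtypeEquivRight fun p => ?_))
      simp only [Finset.mem_filter, Finset.mem_offDiag]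
      constructor
      · rintro ⟨h, h1, h2⟩; exact ⟨⟨h1, h2, h.ne⟩, h⟩
      · rintro ⟨⟨h1, h2, -⟩, h⟩; exact ⟨h, h1, h2⟩
    have hswap : (S.offDiag.filter fun p => ¬p.1 < p.2).card =
        (S.offDiag.filter fun p => p.1 < p.2).card := by
      refine Finset.card_bij' (fun p _ => p.swap) (fun p _ => p.swap) ?_ ?_ ?_ ?_ <;>
        simp <;> grind
    have := Finset.card_filter_add_card_filter_not (s := S.offDiag) (fun p => p.1 < p.2)
    rw [hswap, Finset.offDiag_card, hS, ← e] at this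
    rw [Nat.mul_sub_one, ← this]; ring
  rw [← hinner, Fintype.card_subtype_compl]
  have := Fintype.card_subtype_le fun p : IncPair n => p.1.1 ∈ S ∧ p.1.2 ∈ S
  lia

section Isotropic

variable {K V : Type*} [Field K] [AddCommGroup V] [Module K V] {n : ℕ}

/-- Every subspace contains vectors which, apart from one basis vector indexed by a set `S` of
size the dimension of the subspace, involve only basis vectors outside `S`. -/
theorem exists_pivots (b : Basis (Fin n) K V) (W : Submodule K V) :
    ∃ S : Finset (Fin n), S.card = finrank K W ∧ ∃ a : Fin n → Fin n → K,
      ∀ s ∈ S, b s + ∑ r ∈ Sᶜ, a r s • b r ∈ W := by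
  classical
  have := b.finiteDimensional_of_finite
  obtain ⟨κ, g, hg, hspan, hli⟩ := exists_linearIndependent' K (W.mkQ ∘ b)
  have : Finite κ := Finite.of_injective g hg
  have := Fintype.ofFinite κ
  have htop : Submodule.span K (Set.range (W.mkQ ∘ b)) = ⊤ := by
    rw [Set.range_comp, Submodule.span_image, b.span_eq, Submodule.map_top, Submodule.range_mkQ]
  have hcard : Fintype.card κ = finrank K (V ⧸ W) := by
    rw [← finrank_span_eq_card hli, hspan, htop, finrank_top]
  set T : Finset (Fin n) := Finset.univ.image g with hT
  have hTcard : T.card = finrank K (V ⧸ W) := by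
    rw [hT, Finset.card_image_of_injective _ hg, Finset.card_univ, hcard]
  have hex : ∀ s, ∃ f : Fin n → K, b s + ∑ r ∈ T, f r • b r ∈ W := by
    intro s
    have hs : W.mkQ (b s) ∈ Submodule.span K ((W.mkQ ∘ b) '' T) := by
      have : (W.mkQ ∘ b) '' T = Set.range ((W.mkQ ∘ b) ∘ g) := by
        rw [hT, Finset.coe_image, Finset.coe_univ, Set.image_univ, ← Set.range_comp]
      rw [this, hspan, htop]
      trivial
    obtain ⟨f, hf⟩ := (Submodule.mem_span_image_finset_iff_exists_fun K).1 hs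
    refine ⟨fun r => if h : r ∈ T then -f ⟨r, h⟩ else 0, ?_⟩
    rw [← Submodule.Quotient.mk_eq_zero, ← Submodule.mkQ_apply, map_add, ← hf, map_sum,
      ← Finset.sum_coe_sort T, ← Finset.sum_add_distrib]
    exact Finset.sum_eq_zero fun r _ => by simp
  choose f hf using hex
  refine ⟨Tᶜ, ?_, fun r s => f s r, fun s _ => by simpa using hf s⟩
  have h1 := W.finrank_quotient_add_finrank
  rw [finrank_eq_card_basis b, Fintype.card_fin] at h1
  rw [Finset.card_compl, Fintype.card_fin, hTcard]
  lia

/-- The coefficients of every alternating form for which `W` is isotropic are of the form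
`shearCoeffs S a c`, where `S` and `a` depend only on `W`. -/
theorem exists_shearCoeffs_of_isotropic (b : Basis (Fin n) K V) (W : Submodule K V) :
    ∃ S : Finset (Fin n), S.card = finrank K W ∧ ∃ a : Fin n × S → K,
      ∀ d : IncPair n → K, (∀ x ∈ W, ∀ y ∈ W, altForm b d x y = 0) →
        ∃ c : OuterPair S → K, d = shearCoeffs S a c := by
  obtain ⟨S, hS, a, ha⟩ := exists_pivots b W
  refine ⟨S, hS, fun p => a p.1 p.2, fun d hd => ?_⟩
  set u : Fin n → V := fun i => b i + if i ∈ S then ∑ r ∈ Sᶜ, a r i • b r else 0 with hu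
  have huW : ∀ i ∈ S, u i ∈ W := fun i hi => by simpa [hu, hi] using ha i hi
  have hexp : ∀ i, b i = ∑ r, shear S (fun p => a p.1 p.2) r i • u r := by
    intro i
    by_cases hi : i ∈ S
    · have h1 : ∀ r, shear S (fun p => a p.1 p.2) r i • u r =
          (if r = i then u r else 0) - if r ∈ Sᶜ then a r i • b r else 0 := by
        intro r
        by_cases hr : r ∈ S <;> by_cases hri : r = i <;> simp [shear, hi, hr, hri, hu]
      simp_rw [h1]
      rw [Finset.sum_sub_distrib, Finset.sum_ite_eq', ← Finset.sum_filter]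
      simp [hu, hi, Finset.compl_eq_univ_sdiff, Finset.sdiff_eq_filter]
    · simp only [shear, hi, dite_false, sub_zero, ite_smul, one_smul, zero_smul,
        Finset.sum_ite_eq', Finset.mem_univ, if_true]
      simp [hu, hi]
  refine ⟨fun q => altForm b d (u q.1.1.1) (u q.1.1.2), funext fun p => ?_⟩
  rw [← altForm_basis b d p, hexp p.1.1, hexp p.1.2]
  simp only [map_sum, map_smul, LinearMap.sum_apply, LinearMap.smul_apply, smul_eq_mul]
  have key := sum_sum_mul_of_alternating (fun i j => altForm b d (u i) (u j))
    (fun i => altForm_self b d _) (fun i j => altForm_swap b d _ _)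
    (fun r => shear S (fun p => a p.1 p.2) r p.1.1) (fun r => shear S (fun p => a p.1 p.2) r p.1.2)
  rw [shearCoeffs, ← Finset.sum_subtype (Finset.univ.filter fun q : IncPair n =>
    ¬(q.1.1 ∈ S ∧ q.1.2 ∈ S)) (by simp) fun q : IncPair n => altForm b d (u q.1.1) (u q.1.2) *
      (shear S (fun p => a p.1 p.2) q.1.1 p.1.1 * shear S (fun p => a p.1 p.2) q.1.2 p.1.2 -
      shear S (fun p => a p.1 p.2) q.1.2 p.1.1 * shear S (fun p => a p.1 p.2) q.1.1 p.1.2),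
    Finset.sum_filter_of_ne]
  · rw [← key, Finset.sum_comm]
    simp only [Finset.mul_sum]
    refine Finset.sum_congr rfl fun i _ => Finset.sum_congr rfl fun j _ => ?_
    ring
  · rintro q - hne ⟨h1, h2⟩
    exact hne (by rw [hd _ (huW _ h1) _ (huW _ h2), zero_mul])

end Isotropic

theorem exists_ne_zero_aeval_eq_zero_of_card_lt {σ τ K : Type*} [Fintype σ] [Fintype τ] [Field K]
    (hcard : Fintype.card σ < Fintype.card τ) (f : τ → MvPolynomial σ K) :
    ∃ Q : MvPolynomial τ K, Q ≠ 0 ∧ MvPolynomial.aeval f Q = 0 := by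
  by_contra! hne
  have hf : AlgebraicIndependent K f := by
    rw [algebraicIndependent_iff]
    intro p hp
    by_contra h0
    exact hne p h0 hp
  have := hf.lift_cardinalMk_le_trdeg
  rw [MvPolynomial.trdeg_of_isDomain] at this
  simp at this
  lia

section Existence

variable {K V : Type*} [Field K] [AddCommGroup V] [Module K V] {n k t : ℕ}

theorem exists_coeffs_of_infinite [Infinite K] (hk : 0 < k) (h : 2 * n < t * (k - 1))
    (b : Basis (Fin n) K V) :
    ∃ d : Fin t → IncPair n → K, ∀ W : Submodule K V, finrank K W = k →
      ∃ i, ∃ x ∈ W, ∃ y ∈ W, altForm b (d i) x y ≠ 0 := by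
  classical
  have hQ : ∀ S : Finset (Fin n), ∃ Q : MvPolynomial (Fin t × IncPair n) K, Q ≠ 0 ∧
      (S.card = k → ∀ (a : Fin n × S → K) (c : Fin t → OuterPair S → K),
        MvPolynomial.eval (fun p => shearCoeffs S a (c p.1) p.2) Q = 0) := by
    intro S
    by_cases hS : S.card = k
    · have hcard : Fintype.card ((Fin n × S) ⊕ (Fin t × OuterPair S)) <
          Fintype.card (Fin t × IncPair n) := by
        simp only [Fintype.card_sum, Fintype.card_prod, Fintype.card_fin, Fintype.card_coe, hS]
        have := card_incPair hS
        nlinarith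
      obtain ⟨Q, hQ0, hQ⟩ := exists_ne_zero_aeval_eq_zero_of_card_lt (K := K) hcard
        fun p => shearCoeffs S (fun x => MvPolynomial.X (Sum.inl x))
          (fun x => MvPolynomial.X (Sum.inr (p.1, x))) p.2
      refine ⟨Q, hQ0, fun _ a c => ?_⟩
      have := congrArg (MvPolynomial.eval (Sum.elim a fun x => c x.1 x.2)) hQ
      rw [map_zero, MvPolynomial.aeval_def, MvPolynomial.hom_eval₂] at this
      rw [← this, MvPolynomial.eval, MvPolynomial.coe_eval₂Hom]
      congr 1
      · ext; simp
      · funext p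
        simp [map_shearCoeffs]
    · exact ⟨1, one_ne_zero, fun h => (hS h).elim⟩
  choose Q hQ0 hQ using hQ
  have hprod : ∏ S, Q S ≠ 0 := Finset.prod_ne_zero_iff.2 fun S _ => hQ0 S
  obtain ⟨d, hd⟩ : ∃ d, MvPolynomial.eval d (∏ S, Q S) ≠ 0 := by
    by_contra! hall
    exact hprod (MvPolynomial.funext fun x => by rw [hall x, map_zero])
  refine ⟨fun i p => d (i, p), fun W hW => ?_⟩
  by_contra! hiso
  obtain ⟨S, hS, a, ha⟩ := exists_shearCoeffs_of_isotropic b W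
  choose c hc using fun i => ha _ (hiso i)
  have hdc : d = fun p => shearCoeffs S a (c p.1) p.2 := by
    funext p
    exact congrFun (hc p.1) p.2
  rw [map_prod] at hd
  refine Finset.prod_ne_zero_iff.1 hd S (Finset.mem_univ _) ?_
  rw [hdc]
  exact hQ S (hS.trans hW) a c

theorem card_subspaces_le [Finite K] [FiniteDimensional K V] :
    Nat.card {W : Submodule K V // finrank K W = k} ≤ Nat.card K ^ (k * finrank K V) := by
  have : Finite V := Module.finite_of_finite K
  let f : {W : Submodule K V // finrank K W = k} → Fin k → V :=
    fun W i => (finBasisOfFinrankEq K W.1 W.2 i : V)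
  have hspan : ∀ W, Submodule.span K (Set.range (f W)) = W.1 := by
    intro W
    have := congrArg (Submodule.map W.1.subtype) (finBasisOfFinrankEq K W.1 W.2).span_eq
    rwa [← Submodule.span_image, ← Set.range_comp, Submodule.map_subtype_top] at this
  have hinj : Function.Injective f := fun W W' h =>
    Subtype.ext (by rw [← hspan W, h, hspan W'])
  refine (Nat.card_le_card_of_injective f hinj).trans_eq ?_
  rw [Nat.card_fun, Nat.card_fin, Module.natCard_eq_pow_finrank (K := K) (V := V),
    ← pow_mul, mul_comm]

theorem exists_coeffs_of_finite [Finite K] (hk : 0 < k) (h : 2 * n < t * (k - 1))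
    (b : Basis (Fin n) K V) :
    ∃ d : Fin t → IncPair n → K, ∀ W : Submodule K V, finrank K W = k →
      ∃ i, ∃ x ∈ W, ∃ y ∈ W, altForm b (d i) x y ≠ 0 := by
  classical
  by_contra! hbad
  have := b.finiteDimensional_of_finite
  have : Finite V := Module.finite_of_finite K
  have := Fintype.ofFinite K
  have := Fintype.ofFinite {W : Submodule K V // finrank K W = k}
  choose S hS a ha using fun W : {W : Submodule K V // finrank K W = k} =>
    exists_shearCoeffs_of_isotropic b W.1
  choose W hW hiso using hbad
  choose c hc using fun d i => ha ⟨W d, hW d⟩ _ (hiso d i)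
  let F : (Fin t → IncPair n → K) →
      Σ W : {W : Submodule K V // finrank K W = k}, (Fin t → OuterPair (S W) → K) :=
    fun d => ⟨⟨W d, hW d⟩, c d⟩
  let G : (Σ W : {W : Submodule K V // finrank K W = k}, (Fin t → OuterPair (S W) → K)) →
      (Fin t → IncPair n → K) := fun z i => shearCoeffs (S z.1) (a z.1) (z.2 i)
  have hGF : Function.LeftInverse G F := fun d => funext fun i => (hc d i).symm
  have hle := Fintype.card_le_of_injective F hGF.injective
  obtain ⟨W₀⟩ : Nonempty {W : Submodule K V // finrank K W = k} := ⟨⟨W 0, hW 0⟩⟩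
  have hcard : ∀ W, Fintype.card (OuterPair (S W)) = Fintype.card (OuterPair (S W₀)) := by
    intro W
    have h1 := card_incPair ((hS W).trans W.2)
    have h2 := card_incPair ((hS W₀).trans W₀.2)
    lia
  have hnum := card_subspaces_le (K := K) (V := V) (k := k)
  rw [finrank_eq_card_basis b, Fintype.card_fin, Nat.card_eq_fintype_card,
    Nat.card_eq_fintype_card] at hnum
  simp only [Fintype.card_sigma, Fintype.card_fun, Fintype.card_fin, hcard, Finset.sum_const,
    Finset.card_univ, smul_eq_mul] at hle
  have hle' := hle.trans (Nat.mul_le_mul_right _ hnum)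
  rw [← pow_mul, ← pow_mul, ← pow_add, Nat.pow_le_pow_iff_right Fintype.one_lt_card] at hle'
  have := card_incPair ((hS W₀).trans W₀.2)
  nlinarith

end Existence


/-- If `k`, `t`, `n` are positive integers with `2n < t(k−1)` and `V` is an `n`-dimensional
vector space over a field `K`, then there is a `t`-tuple of alternating bilinear forms on `V`
such that no `k`-dimensional subspace of `V` is simultaneously isotropic for all of them. -/
theorem exists_alternating_forms_no_isotropic_subspace
    (K : Type*) [Field K] (k t n : ℕ) (hk : 0 < k) (ht : 0 < t) (hn : 0 < n)
    (h : 2 * n < t * (k - 1))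
    (V : Type*) [AddCommGroup V] [Module K V] [FiniteDimensional K V]
    (hV : Module.finrank K V = n) :
    ∃ φ : Fin t → (V →ₗ[K] V →ₗ[K] K),
      (∀ i, ∀ v : V, φ i v v = 0) ∧
      ∀ W : Submodule K V, Module.finrank K W = k →
        ∃ i, ∃ x ∈ W, ∃ y ∈ W, φ i x y ≠ 0 := by
  let b := finBasisOfFinrankEq K V hV
  obtain ⟨d, hd⟩ : ∃ d : Fin t → IncPair n → K, ∀ W : Submodule K V, finrank K W = k →
      ∃ i, ∃ x ∈ W, ∃ y ∈ W, altForm b (d i) x y ≠ 0 := by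
    cases finite_or_infinite K
    · exact exists_coeffs_of_finite hk h b
    · exact exists_coeffs_of_infinite hk h b
  exact ⟨fun i => altForm b (d i), fun i => altForm_self b (d i), hd⟩
end
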